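/- Let S = ((x_1,y_1),…,(x_n,y_n)) be a dataset of size n ≥ 1 over X, f : {−1,1}³ → ℝ with coefficients a_y, b_y, Q_y, and g : ℝ → ℝ continuous with antiderivative G(s) := ∫_0^s g(u) du. Define P : ℝⁿ → ℝ by P(ν) := −(1/(4n))·Σ_{i=1}^n (a_{y_i}·G(ν_i) + b_{y_i}·ν_i) and Q̂(ν) := (1/(4n))·Σ_{i=1}^n Q_{y_i}(g(ν_i)). Then P is differentiable with ∂P/∂ν_i(ν) = −(1/(4n))·(a_{y_i}·g(ν_i) + b_{y_i}) for every ν ∈ ℝⁿ and every i, and for all functions c, μ : X → [−1,1]: Σ_{i=1}^n (∂P/∂ν_i)(μ_S)·c(x_i) = −ℓ_S^f(c, g∘μ) + Q̂(μ_S), where μ_S := (μ(x_1),…,μ(x_n)). -/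

import Mathlib

open MeasureTheory

/-- `a_y := f(1,1,y) + f(−1,−1,y) − f(1,−1,y) − f(−1,1,y)`. -/
def acoef (f : ℝ → ℝ → ℝ → ℝ) (y : ℝ) : ℝ :=
  f 1 1 y + f (-1) (-1) y - f 1 (-1) y - f (-1) 1 y

/-- `b_y := f(1,1,y) + f(1,−1,y) − f(−1,1,y) − f(−1,−1,y)`. -/
def bcoef (f : ℝ → ℝ → ℝ → ℝ) (y : ℝ) : ℝ :=
  f 1 1 y + f 1 (-1) y - f (-1) 1 y - f (-1) (-1) y

/-- `Q_y(t) := (1+t)·(f(1,1,y) + f(−1,1,y)) + (1−t)·(f(1,−1,y) + f(−1,−1,y))`. -/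
def Qcoef (f : ℝ → ℝ → ℝ → ℝ) (y t : ℝ) : ℝ :=
  (1+t) * (f 1 1 y + f (-1) 1 y) + (1-t) * (f 1 (-1) y + f (-1) (-1) y)

/-- The antiderivative `G(s) := ∫_0^s g(u) du`. -/
noncomputable def Gant (g : ℝ → ℝ) (s : ℝ) : ℝ := ∫ u in (0:ℝ)..s, g u

/-- The progress measure `P(ν) := −(1/(4n))·Σ_i (a_{y_i}·G(ν_i) + b_{y_i}·ν_i)`. -/
noncomputable def Pfun (f : ℝ → ℝ → ℝ → ℝ) (g : ℝ → ℝ) (n : ℕ) (y : Fin n → ℝ)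
    (ν : Fin n → ℝ) : ℝ :=
  -(1/(4*(n:ℝ))) * ∑ i, (acoef f (y i) * Gant g (ν i) + bcoef f (y i) * ν i)

/-- Fundamental theorem of calculus for `Gant`. -/
lemma hasDerivAt_Gant (g : ℝ → ℝ) (hg : Continuous g) (s : ℝ) :
    HasDerivAt (Gant g) (g s) s :=
  intervalIntegral.integral_hasDerivAt_right (hg.intervalIntegrable _ _)
    (hg.stronglyMeasurableAtFilter _ _) hg.continuousAt

/-- `P` is (jointly) differentiable on `ℝⁿ`. -/
lemma differentiable_Pfun (f : ℝ → ℝ → ℝ → ℝ) (g : ℝ → ℝ) (hg : Continuous g) (n : ℕ)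
    (y : Fin n → ℝ) : Differentiable ℝ (Pfun f g n y) := by
  have hG : Differentiable ℝ (Gant g) := fun s => (hasDerivAt_Gant g hg s).differentiableAt
  unfold Pfun
  fun_prop

/-- `P` has partial derivatives `∂P/∂ν_i(ν) = −(1/(4n))·(a_{y_i}·g(ν_i) + b_{y_i})`, and
the gradient identity `⟨∇P(μ_S), c_S⟩ = −ℓ_S^f(c, g∘μ) + Q̂(μ_S)` holds for all
`c, μ : X → [−1,1]`. -/
theorem stmt14 {X : Type*} (n : ℕ) (hn : 1 ≤ n) (x : Fin n → X) (y : Fin n → ℝ)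
    (hy : ∀ i, y i = 1 ∨ y i = -1) (f : ℝ → ℝ → ℝ → ℝ)
    (g : ℝ → ℝ) (hg : Continuous g) :
    (∀ (ν : Fin n → ℝ) (i : Fin n),
      HasDerivAt (fun t => Pfun f g n y (Function.update ν i t))
        (-(1/(4*(n:ℝ))) * (acoef f (y i) * g (ν i) + bcoef f (y i))) (ν i)) ∧
    (∀ c μ : X → ℝ, (∀ a, c a ∈ Set.Icc (-1:ℝ) 1) → (∀ a, μ a ∈ Set.Icc (-1:ℝ) 1) →
      ∑ i, (-(1/(4*(n:ℝ))) * (acoef f (y i) * g (μ (x i)) + bcoef f (y i))) * c (x i)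
        = -((1/(4*(n:ℝ))) * ∑ i,
              (c (x i) * (acoef f (y i) * g (μ (x i)) + bcoef f (y i))
                + Qcoef f (y i) (g (μ (x i)))))
          + (1/(4*(n:ℝ))) * ∑ i, Qcoef f (y i) (g (μ (x i)))) := by
  refine ⟨fun ν i => ?_, fun c μ _ _ => ?_⟩
  · unfold Pfun
    apply HasDerivAt.const_mul
    have key : ∀ j ∈ Finset.univ, HasDerivAt
        (fun t => acoef f (y j) * Gant g (Function.update ν i t j)
          + bcoef f (y j) * Function.update ν i t j)
        (if j = i then acoef f (y i) * g (ν i) + bcoef f (y i) else 0) (ν i) := by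
      intro j _
      by_cases h : j = i
      · subst h
        simp only [Function.update_self, if_true]
        simpa using ((hasDerivAt_Gant g hg (ν j)).const_mul (acoef f (y j))).fun_add
          ((hasDerivAt_id (ν j)).const_mul (bcoef f (y j)))
      · simp only [Function.update_of_ne h, if_neg h]
        exact hasDerivAt_const _ _
    have := HasDerivAt.fun_sum key
    simpa using this
  · rw [Finset.sum_add_distrib, mul_add, neg_add, neg_add_cancel_right, Finset.mul_sum,
      ← Finset.sum_neg_distrib]
    exact Finset.sum_congr rfl fun i _ => by ring
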